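/- Let W < 0 and define on the open unit disk D = {(u,v) : u² + v² < 1}: P₀(u,v) = (1/2)·√(−W)·(1 − u² − v²) and Ω₀(u,v) = −(1/√(−W))·[ v/(1−u²) + ((1−u²−v²)/(1−u²)^{3/2})·artanh( v/√(1−u²) ) ]. Then Ω₀ is smooth on D (note |v| < √(1−u²) on D, so the artanh is defined) and at every point of D one has P₀(u,v)² · ∂/∂v ( Ω₀/P₀ )(u,v) = −1. -/

import Mathlib

/-- The real inverse hyperbolic tangent function, defined on `(−1,1)` by
`artanh x = (1/2)·ln((1+x)/(1−x))`. -/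
noncomputable def artanh (x : ℝ) : ℝ := (1 / 2) * Real.log ((1 + x) / (1 - x))

/-- The conformal factor for constant Tanaka–Webster curvature `W < 0`. -/
noncomputable def P₀ (W u v : ℝ) : ℝ := (1 / 2) * Real.sqrt (-W) * (1 - u ^ 2 - v ^ 2)

/-- The frame component `Ω₀` for constant Tanaka–Webster curvature `W < 0`. -/
noncomputable def Ω₀ (W u v : ℝ) : ℝ :=
  -(1 / Real.sqrt (-W)) *
    (v / (1 - u ^ 2) +
      ((1 - u ^ 2 - v ^ 2) / (1 - u ^ 2) ^ ((3 : ℝ) / 2)) *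
        artanh (v / Real.sqrt (1 - u ^ 2)))

/-- The open unit disk in `ℝ²`. -/
def unitDisk : Set (ℝ × ℝ) := {p : ℝ × ℝ | p.1 ^ 2 + p.2 ^ 2 < 1}

theorem hasDerivAt_artanh {x : ℝ} (h₁ : -1 < x) (h₂ : x < 1) :
    HasDerivAt artanh (1 / (1 - x ^ 2)) x := by
  have hp : 1 + x ≠ 0 := by linarith
  have hm : 1 - x ≠ 0 := by linarith
  have hq : 1 - x ^ 2 ≠ 0 := by
    rw [show 1 - x ^ 2 = (1 + x) * (1 - x) by ring]
    exact mul_ne_zero hp hm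
  have h := ((((hasDerivAt_id x).const_add 1).div ((hasDerivAt_id x).const_sub 1) hm).log
    (div_ne_zero hp hm)).const_mul (1 / 2 : ℝ)
  refine h.congr_deriv ?_
  simp only [id, Pi.div_apply]
  field_simp
  ring

theorem contDiffAt_artanh {x : ℝ} (h₁ : -1 < x) (h₂ : x < 1) {n : WithTop ℕ∞} :
    ContDiffAt ℝ n artanh x := by
  have hp : 1 + x ≠ 0 := by linarith
  have hm : 1 - x ≠ 0 := by linarith
  exact contDiffAt_const.mul (((contDiffAt_const.add contDiffAt_id).div
    (contDiffAt_const.sub contDiffAt_id) hm).log (div_ne_zero hp hm))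

theorem rpow_three_halves {a : ℝ} (ha : 0 < a) : a ^ ((3 : ℝ) / 2) = a * Real.sqrt a := by
  rw [Real.sqrt_eq_rpow, show (3 : ℝ) / 2 = 1 + 1 / 2 by norm_num, Real.rpow_add ha,
    Real.rpow_one]

theorem div_sqrt_mem_Ioo {a v : ℝ} (h : v ^ 2 < a) : v / Real.sqrt a ∈ Set.Ioo (-1) 1 := by
  have hs : 0 < Real.sqrt a := Real.sqrt_pos.2 ((sq_nonneg v).trans_lt h)
  have hv := Real.sq_lt.1 h
  exact ⟨by rw [lt_div_iff₀ hs]; linarith, by rw [div_lt_one hs]; exact hv.2⟩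

/-- For `W < 0`, the function `Ω₀` is smooth on the open unit disk `D` and solves the
remaining field equation `P₀² · ∂/∂v (Ω₀/P₀) = −1` on `D`. -/
theorem sasakian_omega_neg (W : ℝ) (hW : W < 0) :
    ContDiffOn ℝ (⊤ : ℕ∞) (fun p : ℝ × ℝ => Ω₀ W p.1 p.2) unitDisk ∧
    (∀ u v : ℝ, (u, v) ∈ unitDisk →
      (P₀ W u v) ^ 2 * deriv (fun t => Ω₀ W u t / P₀ W u t) v = -1) := by
  constructor
  · rintro ⟨u, v⟩ hp
    have hp' : u ^ 2 + v ^ 2 < 1 := hp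
    have ha : 0 < 1 - u ^ 2 := by nlinarith [sq_nonneg v]
    have hx := div_sqrt_mem_Ioo (show v ^ 2 < 1 - u ^ 2 by linarith)
    have hu : ContDiffAt ℝ (⊤ : ℕ∞) (fun p : ℝ × ℝ => 1 - p.1 ^ 2) (u, v) := by fun_prop
    have hv : ContDiffAt ℝ (⊤ : ℕ∞) (fun p : ℝ × ℝ => p.2) (u, v) := by fun_prop
    have hs := hv.div (hu.sqrt ha.ne') (Real.sqrt_pos.2 ha).ne'
    have hart : ContDiffAt ℝ (⊤ : ℕ∞)
        (fun p : ℝ × ℝ => artanh (p.2 / Real.sqrt (1 - p.1 ^ 2))) (u, v) :=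
      ContDiffAt.comp (u, v) (g := artanh) (contDiffAt_artanh hx.1 hx.2) hs
    exact (contDiffAt_const.mul ((hv.div hu ha.ne').add
      (((hu.sub (hv.pow 2)).div (hu.rpow_const_of_ne ha.ne')
        (Real.rpow_pos_of_pos ha _).ne').mul hart))).contDiffWithinAt
  · intro u v hp
    have hp' : u ^ 2 + v ^ 2 < 1 := hp
    have ha : 0 < 1 - u ^ 2 := by nlinarith [sq_nonneg v]
    have hQ : 1 - u ^ 2 - v ^ 2 ≠ 0 := by linarith
    have hx := div_sqrt_mem_Ioo (show v ^ 2 < 1 - u ^ 2 by linarith)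
    have hw : 0 < Real.sqrt (-W) := Real.sqrt_pos.2 (by linarith)
    have hs : 0 < Real.sqrt (1 - u ^ 2) := Real.sqrt_pos.2 ha
    have hs2 : Real.sqrt (1 - u ^ 2) ^ 2 = 1 - u ^ 2 := Real.sq_sqrt ha.le
    have hr := rpow_three_halves ha
    unfold Ω₀ P₀
    rw [hr]
    generalize Real.sqrt (-W) = w at *
    generalize Real.sqrt (1 - u ^ 2) = s at *
    clear hr
    rw [← hs2] at hQ ⊢
    have hart : HasDerivAt (fun t => artanh (t / s)) (1 / (1 - (v / s) ^ 2) * (1 / s)) v :=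
      HasDerivAt.comp (h₂ := artanh) (h := fun t => t / s) v
        (hasDerivAt_artanh hx.1 hx.2) ((hasDerivAt_id v).div_const s)
    have hQd : HasDerivAt (fun t : ℝ => s ^ 2 - t ^ 2) (-(2 * v)) v := by
      simpa using (hasDerivAt_pow 2 v).const_sub (s ^ 2)
    have hΩ := (((hasDerivAt_id v).div_const (s ^ 2)).add
      ((hQd.div_const (s ^ 2 * s)).mul hart)).const_mul (-(1 / w))
    have h := hΩ.div (hQd.const_mul (1 / 2 * w))
      (mul_ne_zero (mul_ne_zero (by norm_num) hw.ne') hQ)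
    refine (congrArg _ h.deriv).trans ?_
    have hxs : 1 - (v / s) ^ 2 = (s ^ 2 - v ^ 2) / s ^ 2 := by field_simp
    rw [hxs]
    simp only [id, Pi.add_apply, Pi.mul_apply]
    generalize artanh (v / s) = A
    field_simp
    ring
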